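/- The complex vector space of infinitesimal symmetries of the trivial system (S_0): u^k_{x_i x_j} = 0, with θ, η holomorphic on all of ℂ^n × ℂ^m, has complex dimension exactly (n+m+2)(n+m). In particular the upper bound (n+m+2)(n+m) for the dimension of the symmetry algebra of a holomorphic completely overdetermined involutive second order system is attained. -/

import Mathlib

open scoped BigOperators

noncomputable section

/-- The space of independent and dependent variables `(x, u) ∈ ℂⁿ × ℂᵐ`. -/
abbrev Wsp (n m : ℕ) := (Fin n → ℂ) × (Fin m → ℂ)

/-- The space of first-order jet variables `q = (q_i^k)`, with `q k i` standing for
`∂u^k/∂x_i`. -/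
abbrev Jsp (n m : ℕ) := Fin m → Fin n → ℂ

/-- The first-order jet space `ℂⁿ × ℂᵐ × ℂ^{mn}` with coordinates `(x, u, q)`. -/
abbrev Psp (n m : ℕ) := Wsp n m × Jsp n m

/-- Coordinate direction `∂/∂x_i` in the jet space. -/
def dirx (n m : ℕ) (i : Fin n) : Psp n m := (((Pi.single i 1 : Fin n → ℂ), 0), 0)

/-- Coordinate direction `∂/∂u^k` in the jet space. -/
def diru (n m : ℕ) (k : Fin m) : Psp n m := ((0, (Pi.single k 1 : Fin m → ℂ)), 0)

/-- Coordinate direction `∂/∂q_j^k` in the jet space. -/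
def dirq (n m : ℕ) (k : Fin m) (j : Fin n) : Psp n m :=
  ((0, 0), (Pi.single k (Pi.single j 1) : Fin m → Fin n → ℂ))

/-- The total derivative `D_i` applied to a function `ψ(x, u)` of the base
variables only: `D_i ψ = ∂ψ/∂x_i + Σ_k q_i^k ∂ψ/∂u^k`. -/
def Dtot {n m : ℕ} (ψ : Wsp n m → ℂ) (i : Fin n) (p : Psp n m) : ℂ :=
  fderiv ℂ ψ p.1 ((Pi.single i 1 : Fin n → ℂ), 0)
    + ∑ k, p.2 k i * fderiv ℂ ψ p.1 (0, (Pi.single k 1 : Fin m → ℂ))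

/-- The total derivative `D_i^F` of the system `(S_F)` applied to a function
`φ(x, u, q)`: `D_i^F φ = ∂φ/∂x_i + Σ_k q_i^k ∂φ/∂u^k + Σ_{k,j} F_{ij}^k ∂φ/∂q_j^k`. -/
def DtotF {n m : ℕ} (F : Fin n → Fin n → Fin m → Psp n m → ℂ)
    (φ : Psp n m → ℂ) (i : Fin n) (p : Psp n m) : ℂ :=
  fderiv ℂ φ p (dirx n m i) + ∑ k, p.2 k i * fderiv ℂ φ p (diru n m k)
    + ∑ k, ∑ j, F i j k p * fderiv ℂ φ p (dirq n m k j)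

/-- The first prolongation coefficient `η_i^μ = D_i η^μ − Σ_j (D_i θ_j) q_j^μ`. -/
def eta1 {n m : ℕ} (θ : Fin n → Wsp n m → ℂ) (η : Fin m → Wsp n m → ℂ)
    (μ : Fin m) (i : Fin n) (p : Psp n m) : ℂ :=
  Dtot (η μ) i p - ∑ j, Dtot (θ j) i p * p.2 μ j

/-- The second prolongation coefficient `η_{ij}^μ = D_j^F η_i^μ − Σ_k (D_j θ_k) F_{ik}^μ`. -/
def eta2 {n m : ℕ} (F : Fin n → Fin n → Fin m → Psp n m → ℂ)
    (θ : Fin n → Wsp n m → ℂ) (η : Fin m → Wsp n m → ℂ)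
    (μ : Fin m) (i j : Fin n) (p : Psp n m) : ℂ :=
  DtotF F (eta1 θ η μ i) j p - ∑ k, Dtot (θ k) j p * F i k μ p

/-- The pair `(θ, η)` is an infinitesimal symmetry of the system `(S_F)` on `U × Q`:
the determining identity
`η_{ij}^μ = Σ_s θ_s ∂F_{ij}^μ/∂x_s + Σ_k η^k ∂F_{ij}^μ/∂u^k + Σ_{k,l} η_l^k ∂F_{ij}^μ/∂q_l^k`
holds identically on `U × Q` for all `i, j, μ`. -/
def IsSymmetry {n m : ℕ} (U : Set (Wsp n m)) (Q : Set (Jsp n m))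
    (F : Fin n → Fin n → Fin m → Psp n m → ℂ)
    (θ : Fin n → Wsp n m → ℂ) (η : Fin m → Wsp n m → ℂ) : Prop :=
  ∀ p ∈ U ×ˢ Q, ∀ (i j : Fin n) (μ : Fin m),
    eta2 F θ η μ i j p =
      (∑ s, θ s p.1 * fderiv ℂ (F i j μ) p (dirx n m s))
      + (∑ k, η k p.1 * fderiv ℂ (F i j μ) p (diru n m k))
      + (∑ k, ∑ l, eta1 θ η k l p * fderiv ℂ (F i j μ) p (dirq n m k l))

/-- The vector field `Z_i = ∂/∂x_i + Σ_k q_i^k ∂/∂u^k + Σ_{k,j} F_{ij}^k ∂/∂q_j^k`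
on the jet space. -/
def Zfield {n m : ℕ} (F : Fin n → Fin n → Fin m → Psp n m → ℂ) (i : Fin n)
    (p : Psp n m) : Psp n m :=
  dirx n m i + (∑ k, p.2 k i • diru n m k) + ∑ k, ∑ j, F i j k p • dirq n m k j

/-- The system `(S_F)` is involutive: the fields `Z_i` pairwise commute on `U × Q`. -/
def IsInvolutive {n m : ℕ} (U : Set (Wsp n m)) (Q : Set (Jsp n m))
    (F : Fin n → Fin n → Fin m → Psp n m → ℂ) : Prop :=
  ∀ p ∈ U ×ˢ Q, ∀ i j : Fin n,
    fderiv ℂ (Zfield F j) p (Zfield F i p) = fderiv ℂ (Zfield F i) p (Zfield F j p)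

/-- The set of entire infinitesimal symmetries of the trivial system
`(S_0) : u^k_{x_i x_j} = 0`, i.e. pairs `(θ, η)` of entire holomorphic functions on
`ℂⁿ × ℂᵐ` satisfying the determining identity `η_{ij}^μ = 0` identically. -/
def EntireSym0 (n m : ℕ) :
    Set ((Fin n → Wsp n m → ℂ) × (Fin m → Wsp n m → ℂ)) :=
  {X | (∀ j, Differentiable ℂ (X.1 j)) ∧ (∀ μ, Differentiable ℂ (X.2 μ)) ∧
    IsSymmetry Set.univ Set.univ (fun _ _ _ _ => 0) X.1 X.2}

set_option linter.unusedSectionVars false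
section Hol
variable {E F : Type*} [NormedAddCommGroup E] [NormedSpace ℂ E] [FiniteDimensional ℂ E]
  [NormedAddCommGroup F] [NormedSpace ℂ F] [FiniteDimensional ℂ F]

theorem hasDerivAt_line {f : E → F} (hf : Differentiable ℂ f) (w v : E) (t : ℂ) :
    HasDerivAt (fun s : ℂ => f (w + s • v)) (fderiv ℂ f (w + t • v) v) t := by
  have h1 : HasDerivAt (fun s : ℂ => w + s • v) v t := by
    simpa using ((hasDerivAt_id t).smul_const v).const_add w
  exact (hf (w + t • v)).hasFDerivAt.comp_hasDerivAt t h1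

theorem fderiv_bound {f : E → F} (hf : Differentiable ℂ f) (R : ℝ) :
    ∃ C : NNReal, ∀ w ∈ Metric.ball (0 : E) R, ‖fderiv ℂ f w‖₊ ≤ C := by
  have : ProperSpace E := FiniteDimensional.proper ℂ E
  obtain ⟨C, hC⟩ := (isCompact_closedBall (0 : E) (R + 1)).exists_bound_of_continuousOn
    hf.continuous.continuousOn
  refine ⟨C.toNNReal, fun w hw => ?_⟩
  rw [mem_ball_zero_iff] at hw
  have hw0 : ‖f w‖ ≤ C := hC w (by rw [mem_closedBall_zero_iff]; linarith)
  have hC0 : 0 ≤ C := (norm_nonneg _).trans hw0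
  rw [← NNReal.coe_le_coe, coe_nnnorm, Real.coe_toNNReal _ hC0]
  refine ContinuousLinearMap.opNorm_le_bound _ hC0 fun v => ?_
  by_cases hv : v = 0
  · simp [hv]
  have hv' : 0 < ‖v‖ := norm_pos_iff.mpr hv
  have h := hasDerivAt_line hf w v 0
  have hd : Differentiable ℂ (fun s : ℂ => f (w + s • v)) := fun t =>
    (hasDerivAt_line hf w v t).differentiableAt
  have h2 := Complex.norm_deriv_le_of_forall_mem_sphere_norm_le (R := 1 / ‖v‖) (c := 0) (C := C)
    (by positivity) hd.diffContOnCl (fun z hz => by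
      refine hC _ ?_
      rw [mem_closedBall_zero_iff]
      rw [mem_sphere_zero_iff_norm] at hz
      have h3 := norm_add_le w (z • v)
      rw [norm_smul, hz, one_div, inv_mul_cancel₀ hv'.ne'] at h3
      linarith)
  rw [h.deriv] at h2
  simpa using h2

theorem fderiv_apply_diff {f : E → F} (hf : Differentiable ℂ f) (v : E) :
    Differentiable ℂ (fun w => fderiv ℂ f w v) := by
  have : ProperSpace E := FiniteDimensional.proper ℂ E
  have : CompleteSpace F := FiniteDimensional.complete ℂ F
  have : ProperSpace (E →L[ℂ] F) := FiniteDimensional.proper ℂ _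
  let : MeasurableSpace E := borel E
  have : BorelSpace E := ⟨rfl⟩
  have key : (fun w => fderiv ℂ f w v) = fun w => (2 * Real.pi * Complex.I : ℂ)⁻¹ •
      ∫ t in (0:ℝ)..2 * Real.pi, (deriv (circleMap 0 1) t * (1 / (circleMap 0 1 t - 0) ^ 2)) •
        f (w + circleMap 0 1 t • v) := by
    funext w
    have h := hasDerivAt_line hf w v 0
    have hd : Differentiable ℂ (fun s : ℂ => f (w + s • v)) := fun t =>
      (hasDerivAt_line hf w v t).differentiableAt
    have h2 := hd.diffContOnCl.deriv_eq_smul_circleIntegral (R := 1) (c := 0) one_pos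
    rw [h.deriv] at h2
    simp only [zero_smul, add_zero] at h2
    rw [eq_inv_smul_iff₀ (by simp [Real.pi_ne_zero]), ← h2, circleIntegral]
    simp only [mul_smul]
  rw [key]
  intro w₀
  apply DifferentiableAt.const_smul
  obtain ⟨C, hC⟩ := fderiv_bound hf (‖w₀‖ + 1 + ‖v‖)
  have hg : Continuous fun t : ℝ => (deriv (circleMap 0 1) t * (1 / (circleMap 0 1 t - 0) ^ 2)) := by
    simp only [deriv_circleMap, sub_zero]
    have h1 := continuous_circleMap 0 1
    refine (h1.mul continuous_const).mul (continuous_const.div (h1.pow 2) fun t => ?_)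
    exact pow_ne_zero 2 (circleMap_ne_center one_ne_zero)
  have hcm : Continuous fun t : ℝ => circleMap 0 1 t := continuous_circleMap 0 1
  have hnorm : ∀ t : ℝ, ‖(deriv (circleMap 0 1) t * (1 / (circleMap 0 1 t - 0) ^ 2))‖ = 1 := by
    intro t
    simp
  have := intervalIntegral.hasFDerivAt_integral_of_dominated_loc_of_lip (𝕜 := ℂ)
    (μ := MeasureTheory.volume) (a := 0) (b := 2 * Real.pi)
    (F := fun w t => (deriv (circleMap 0 1) t * (1 / (circleMap 0 1 t - 0) ^ 2)) •
        f (w + circleMap 0 1 t • v))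
    (F' := fun t => (deriv (circleMap 0 1) t * (1 / (circleMap 0 1 t - 0) ^ 2)) •
        fderiv ℂ f (w₀ + circleMap 0 1 t • v)) (x₀ := w₀) (bound := fun _ => C)
    (Metric.ball_mem_nhds w₀ one_pos) ?_ ?_ ?_ ?_ ?_ ?_
  · exact this.2.differentiableAt
  · refine Filter.Eventually.of_forall fun w => ?_
    exact (hg.smul (hf.continuous.comp (by fun_prop))).aestronglyMeasurable
  · exact (hg.smul (hf.continuous.comp (by fun_prop))).intervalIntegrable _ _
  · refine MeasureTheory.AEStronglyMeasurable.smul hg.aestronglyMeasurable ?_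
    have hm : Measurable fun t : ℝ => fderiv ℂ f (w₀ + circleMap 0 1 t • v) :=
      (measurable_fderiv ℂ f).comp (Continuous.measurable (by fun_prop))
    exact hm.stronglyMeasurable.aestronglyMeasurable
  · refine Filter.Eventually.of_forall fun t _ => ?_
    have hl : LipschitzOnWith C f (Metric.ball (0 : E) (‖w₀‖ + 1 + ‖v‖)) :=
      (convex_ball _ _).lipschitzOnWith_of_nnnorm_fderiv_le (𝕜 := ℂ) (fun x _ => hf x) hC
    have hmem : ∀ x ∈ Metric.ball w₀ 1, x + circleMap 0 1 t • v ∈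
        Metric.ball (0 : E) (‖w₀‖ + 1 + ‖v‖) := by
      intro x hx
      rw [mem_ball_zero_iff]
      rw [mem_ball_iff_norm] at hx
      have h1 : ‖circleMap 0 1 t • v‖ = ‖v‖ := by simp [norm_smul]
      have h2 := norm_add_le x (circleMap 0 1 t • v)
      have h3 := norm_sub_norm_le x w₀
      linarith
    refine LipschitzOnWith.of_dist_le_mul fun x hx y hy => ?_
    have h := hl.dist_le_mul _ (hmem x hx) _ (hmem y hy)
    simp only [dist_eq_norm, ← smul_sub, norm_smul] at h ⊢
    rw [hnorm]
    simpa using h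
  · exact intervalIntegrable_const
  · refine Filter.Eventually.of_forall fun t _ => ?_
    refine HasFDerivAt.const_smul ?_ _
    have := (hf (w₀ + circleMap 0 1 t • v)).hasFDerivAt.comp w₀
      ((hasFDerivAt_id w₀).add_const (circleMap 0 1 t • v))
    simp only [ContinuousLinearMap.comp_id] at this
    exact this

theorem fderiv_diff {f : E → F} (hf : Differentiable ℂ f) :
    Differentiable ℂ (fderiv ℂ f) := by
  let b := Module.finBasis ℂ E
  have : fderiv ℂ f = fun w => ∑ i, (LinearMap.toContinuousLinearMap (b.coord i)).smulRight
      (fderiv ℂ f w (b i)) := by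
    funext w
    ext v
    conv_lhs => rw [← b.sum_repr v, map_sum]
    simp
  rw [this]
  refine Differentiable.fun_sum fun i _ => ?_
  exact ((ContinuousLinearMap.smulRightL ℂ E F
    (LinearMap.toContinuousLinearMap (b.coord i))).differentiable).comp
      (fderiv_apply_diff hf (b i))
end Hol
section Alg
variable {E : Type*} [NormedAddCommGroup E] [NormedSpace ℂ E] [FiniteDimensional ℂ E]

theorem lin_of_quad (Q : E →L[ℂ] E →L[ℂ] E) (hs : ∀ a b, Q a b = Q b a)
    (h : ∀ v, ∃ c : ℂ, Q v v = c • v) : ∃ l : E →ₗ[ℂ] ℂ, ∀ v, Q v v = l v • v := by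
  classical
  choose c₀ hc₀ using h
  let c : E → ℂ := fun v => if v = 0 then 0 else c₀ v
  have hc : ∀ v, Q v v = c v • v := by
    intro v
    by_cases hv : v = 0
    · simp [hv]
    · simp only [c, hv, if_false]; exact hc₀ v
  have c0 : c 0 = 0 := by simp [c]
  have hsm : ∀ (t : ℂ) v, c (t • v) = t * c v := by
    intro t v
    by_cases ht : t = 0
    · simp [ht, c0]
    by_cases hv : v = 0
    · simp [hv, c0]
    have h1 := hc (t • v)
    simp only [map_smul, smul_apply, hc v, smul_smul] at h1
    have h2 := smul_left_injective ℂ hv h1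
    apply mul_right_cancel₀ ht
    rw [← h2]; ring
  have hadd : ∀ a b, c (a + b) = c a + c b := by
    intro a b
    by_cases hi : LinearIndependent ℂ ![a, b]
    · rw [LinearIndependent.pair_iff] at hi
      have h1 := hc (a + b)
      have h2 := hc (a - b)
      simp only [map_add, map_sub, add_apply,
        sub_apply, hc a, hc b, hs b a] at h1 h2
      have h3 := hi (c (a + b) + c (a - b) - 2 * c a) (c (a + b) - c (a - b) - 2 * c b) (by
        linear_combination (norm := module) - h1 - h2)
      linear_combination (1/2) * h3.1 + (1/2) * h3.2
    · rw [LinearIndependent.pair_iff] at hi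
      push Not at hi
      obtain ⟨s, t, hst, hne⟩ := hi
      by_cases hs0 : s = 0
      · have ht : t ≠ 0 := hne hs0
        have : b = 0 := by simpa [hs0, ht] using hst
        simp [this, c0]
      · have : a = (-(t / s)) • b := by
          have h5 : s • a = s • ((-(t / s)) • b) := by
            rw [smul_smul, mul_neg, mul_div_cancel₀ _ hs0, neg_smul]
            exact eq_neg_of_add_eq_zero_left hst
          exact smul_right_injective E hs0 h5
        rw [this]
        have h6 : (-(t / s)) • b + b = (-(t / s) + 1) • b := by rw [add_smul, one_smul]
        rw [h6, hsm, hsm]; ring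
  exact ⟨{ toFun := c, map_add' := hadd, map_smul' := hsm }, hc⟩

theorem tri_zero (T : E →L[ℂ] E →L[ℂ] E →L[ℂ] E) (h1 : ∀ a b c, T c a b = T c b a)
    (h2 : ∀ a b c, T c a b = T a c b) (h : ∀ c v, ∃ k : ℂ, T c v v = k • v)
    (hE : 1 < Module.finrank ℂ E) (a : E) : T a a a = 0 := by
  by_cases ha : a = 0
  · simp [ha]
  obtain ⟨b, hi⟩ := exists_linearIndependent_pair_of_one_lt_finrank hE ha
  rw [LinearIndependent.pair_iff] at hi
  obtain ⟨α, hα⟩ := h a a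
  obtain ⟨β, hβ⟩ := h b a
  obtain ⟨γ, hγ⟩ := h a b
  obtain ⟨k, hk⟩ := h a (a + b)
  obtain ⟨l, hl⟩ := h a (a - b)
  have e1 : T a b a = T b a a := h2 _ _ _
  have e2 : T a a b = T b a a := by rw [h1, e1]
  simp only [map_add, map_sub, add_apply,
        sub_apply, e1, e2, hα, hβ, hγ] at hk hl
  have i1 := hi (α + 2 * β - k) (γ - k) (by linear_combination (norm := module) hk)
  have i2 := hi (α - 2 * β - l) (γ + l) (by linear_combination (norm := module) hl)
  have : α = 0 := by
    linear_combination (1/2) * i1.1 - (1/2) * i1.2 + (1/2) * i2.1 + (1/2) * i2.2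
  rw [hα, this, zero_smul]

theorem hasDerivAt_line2 {f : E → E →L[ℂ] E →L[ℂ] E} (hf : Differentiable ℂ f) (w c a b : E)
    (t : ℂ) : HasDerivAt (fun s : ℂ => f (w + s • c) a b) (fderiv ℂ f (w + t • c) c a b) t := by
  exact ((ContinuousLinearMap.apply ℂ E b).comp
    (ContinuousLinearMap.apply ℂ (E →L[ℂ] E) a)).hasFDerivAt.comp_hasDerivAt t
      (hasDerivAt_line (F := E →L[ℂ] E →L[ℂ] E) hf w c t)

theorem hasDerivAt_line1 {f : E → E →L[ℂ] E} (hf : Differentiable ℂ f) (w c a : E)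
    (t : ℂ) : HasDerivAt (fun s : ℂ => f (w + s • c) a) (fderiv ℂ f (w + t • c) c a) t := by
  exact (ContinuousLinearMap.apply ℂ E a).hasFDerivAt.comp_hasDerivAt t
      (hasDerivAt_line hf w c t)

theorem struct_thm {X : E → E} (hX : Differentiable ℂ X) (hE : 1 < Module.finrank ℂ E)
    (hB : ∀ w v, ∃ k : ℂ, fderiv ℂ (fderiv ℂ X) w v v = k • v) :
    ∃ (A : E) (L : E →ₗ[ℂ] E) (l : E →ₗ[ℂ] ℂ), ∀ w, X w = A + L w + l w • w := by
  have d1 := fderiv_diff hX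
  have d2 := fderiv_diff d1
  have d3 := fderiv_diff d2
  have sB : ∀ w a b, fderiv ℂ (fderiv ℂ X) w a b = fderiv ℂ (fderiv ℂ X) w b a := fun w a b =>
    second_derivative_symmetric (fun y => (hX y).hasFDerivAt) (d1 w).hasFDerivAt a b
  have hT : ∀ w a, fderiv ℂ (fderiv ℂ (fderiv ℂ X)) w a a a = 0 := by
    intro w a
    refine tri_zero _ ?_ ?_ ?_ hE a
    · intro a b c
      have e1 := hasDerivAt_line2 d2 w c a b 0
      have e2 := hasDerivAt_line2 d2 w c b a 0
      simp only [sB _ a b] at e1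
      simpa using e1.unique e2
    · intro a b c
      rw [second_derivative_symmetric (fun y => (d1 y).hasFDerivAt) (d2 w).hasFDerivAt c a]
    · intro c v
      by_cases hv : v = 0
      · exact ⟨0, by simp [hv]⟩
      obtain ⟨φ, hφ⟩ := SeparatingDual.exists_eq_one (R := ℂ) hv
      have e : ∀ y, fderiv ℂ (fderiv ℂ X) y v v = φ (fderiv ℂ (fderiv ℂ X) y v v) • v := by
        intro y
        obtain ⟨k, hk⟩ := hB y v
        rw [hk]; simp [hφ]
      have e1 := hasDerivAt_line2 d2 w c v v 0
      have e2 := (φ.hasFDerivAt.comp_hasDerivAt (0:ℂ) e1).smul_const v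
      simp only [Function.comp_def, ← e] at e2
      refine ⟨φ (fderiv ℂ (fderiv ℂ (fderiv ℂ X)) w c v v), ?_⟩
      simpa using e1.unique e2
  obtain ⟨l, hl⟩ := lin_of_quad (fderiv ℂ (fderiv ℂ X) 0) (sB 0) (hB 0)
  refine ⟨X 0, (fderiv ℂ X 0 : E →ₗ[ℂ] E), (1/2 : ℂ) • l, fun v => ?_⟩
  have g2 : ∀ t : ℂ, fderiv ℂ (fderiv ℂ X) (0 + t • v) v v = l v • v := by
    intro t
    have hd : ∀ t : ℂ, HasDerivAt (fun s : ℂ => fderiv ℂ (fderiv ℂ X) (0 + s • v) v v) 0 t := by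
      intro t
      have := hasDerivAt_line2 d2 0 v v v t
      rwa [hT] at this
    have := is_const_of_deriv_eq_zero (fun t => (hd t).differentiableAt)
      (fun t => (hd t).deriv) t 0
    rw [← hl]
    simpa using this
  have g1 : ∀ t : ℂ, fderiv ℂ X (0 + t • v) v = fderiv ℂ X 0 v + t • (l v • v) := by
    intro t
    have hd : ∀ t : ℂ, HasDerivAt (fun s : ℂ => fderiv ℂ X (0 + s • v) v - s • (l v • v)) 0 t := by
      intro t
      have := (hasDerivAt_line1 d1 0 v v t).fun_sub ((hasDerivAt_id t).smul_const (l v • v))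
      rw [g2] at this
      simpa using this
    have := is_const_of_deriv_eq_zero (fun t => (hd t).differentiableAt)
      (fun t => (hd t).deriv) t 0
    rw [← sub_eq_iff_eq_add]
    simpa using this
  have g0 : X (0 + (1:ℂ) • v) = X 0 + fderiv ℂ X 0 v + (1/2 : ℂ) • (l v • v) := by
    have hd : ∀ t : ℂ, HasDerivAt (fun s : ℂ => X (0 + s • v) - s • fderiv ℂ X 0 v
        - ((1/2) * s^2 : ℂ) • (l v • v)) 0 t := by
      intro t
      have h2 : HasDerivAt (fun s : ℂ => (1/2) * s^2) t t := by
        have := (hasDerivAt_pow 2 t).const_mul (1/2 : ℂ)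
        exact this.congr_deriv (by push_cast; ring)
      have := ((hasDerivAt_line hX 0 v t).fun_sub ((hasDerivAt_id t).smul_const (fderiv ℂ X 0 v))).fun_sub
        (h2.smul_const (l v • v))
      rw [g1] at this
      simpa using this
    have := is_const_of_deriv_eq_zero (fun t => (hd t).differentiableAt)
      (fun t => (hd t).deriv) 1 0
    simp only [one_smul, zero_smul, add_zero, zero_add, sub_zero] at this ⊢
    rw [sub_sub, sub_eq_iff_eq_add] at this
    rw [this]
    simp [add_assoc]
  simp only [zero_add, one_smul] at g0
  rw [g0]
  simp [smul_smul]

end Alg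
section Jets
variable {n m : ℕ}

def vv (q : Jsp n m) (i : Fin n) : Wsp n m := (Pi.single i 1, fun k => q k i)

theorem vv_eq (q : Jsp n m) (i : Fin n) :
    vv q i = ((Pi.single i 1 : Fin n → ℂ), (0 : Fin m → ℂ))
      + ∑ k, q k i • ((0 : Fin n → ℂ), (Pi.single k 1 : Fin m → ℂ)) := by
  ext s
  · simp [vv, Prod.fst_sum]
  · simp [vv, Prod.snd_sum, Pi.single_apply]

theorem Dtot_eq (ψ : Wsp n m → ℂ) (i : Fin n) (p : Psp n m) :
    Dtot ψ i p = fderiv ℂ ψ p.1 (vv p.2 i) := by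
  rw [vv_eq, map_add, map_sum]
  simp only [map_smul, smul_eq_mul, Dtot]

theorem DtotF_eq (φ : Psp n m → ℂ) (j : Fin n) (p : Psp n m) :
    DtotF (fun _ _ _ _ => 0) φ j p = fderiv ℂ φ p (vv p.2 j, 0) := by
  have : ((vv p.2 j, 0) : Psp n m) = dirx n m j + ∑ k, p.2 k j • diru n m k := by
    rw [vv_eq]
    refine Prod.ext ?_ ?_
    · simp [dirx, diru, Prod.fst_sum]
    · simp [dirx, diru, Prod.snd_sum]
  rw [this, map_add, map_sum]
  simp [DtotF]

theorem eta2_eq {θ : Fin n → Wsp n m → ℂ} {η : Fin m → Wsp n m → ℂ}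
    (hθ : ∀ j, Differentiable ℂ (θ j)) (hη : ∀ μ, Differentiable ℂ (η μ))
    (μ : Fin m) (i j : Fin n) (p : Psp n m) :
    eta2 (fun _ _ _ _ => 0) θ η μ i j p
      = fderiv ℂ (fderiv ℂ (η μ)) p.1 (vv p.2 j) (vv p.2 i)
        - ∑ l, fderiv ℂ (fderiv ℂ (θ l)) p.1 (vv p.2 j) (vv p.2 i) * p.2 μ l := by
  have hvv : Differentiable ℂ (fun p : Psp n m => vv p.2 i) := by
    unfold vv; fun_prop
  have hD : ∀ ψ : Wsp n m → ℂ, Differentiable ℂ ψ →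
      Differentiable ℂ (fun p : Psp n m => fderiv ℂ ψ p.1 (vv p.2 i)) := by
    intro ψ hψ
    exact ((fderiv_diff hψ).comp differentiable_fst).clm_apply hvv
  have heta : eta1 θ η μ i = fun p => fderiv ℂ (η μ) p.1 (vv p.2 i)
      - ∑ l, fderiv ℂ (θ l) p.1 (vv p.2 i) * p.2 μ l := by
    funext p
    simp only [eta1, Dtot_eq]
  have hd : Differentiable ℂ (eta1 θ η μ i) := by
    rw [heta]
    refine (hD _ (hη μ)).fun_sub (Differentiable.fun_sum fun l _ => ?_)
    exact (hD _ (hθ l)).fun_mul (by fun_prop)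
  have h1 : HasDerivAt (fun s : ℂ => eta1 θ η μ i (p + s • (vv p.2 j, 0)))
      (fderiv ℂ (eta1 θ η μ i) p (vv p.2 j, 0)) 0 := by
    simpa using hasDerivAt_line hd p (vv p.2 j, 0) 0
  have hL : ∀ ψ : Wsp n m → ℂ, Differentiable ℂ ψ →
      HasDerivAt (fun s : ℂ => fderiv ℂ ψ (p.1 + s • vv p.2 j) (vv p.2 i))
        (fderiv ℂ (fderiv ℂ ψ) p.1 (vv p.2 j) (vv p.2 i)) 0 := by
    intro ψ hψ
    have := (ContinuousLinearMap.apply ℂ ℂ (vv p.2 i)).hasFDerivAt.comp_hasDerivAt (0:ℂ)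
      (hasDerivAt_line (fderiv_diff hψ) p.1 (vv p.2 j) 0)
    simp only [zero_smul, add_zero] at this
    exact this
  have h2 : HasDerivAt (fun s : ℂ => eta1 θ η μ i (p + s • (vv p.2 j, 0)))
      (fderiv ℂ (fderiv ℂ (η μ)) p.1 (vv p.2 j) (vv p.2 i)
        - ∑ l, fderiv ℂ (fderiv ℂ (θ l)) p.1 (vv p.2 j) (vv p.2 i) * p.2 μ l) 0 := by
    rw [heta]
    simp only [Prod.fst_add, Prod.snd_add, Prod.smul_fst, Prod.smul_snd, smul_zero, add_zero]
    refine (hL _ (hη μ)).fun_sub (HasDerivAt.fun_sum fun l _ => ?_)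
    exact (hL _ (hθ l)).mul_const _
  rw [← h1.unique h2]
  simp [eta2, DtotF_eq]

theorem comp_D2 {E : Type*} [NormedAddCommGroup E] [NormedSpace ℂ E] [FiniteDimensional ℂ E]
    {X : E → E} (hX : Differentiable ℂ X) (φ : E →L[ℂ] ℂ) (w a b : E) :
    fderiv ℂ (fderiv ℂ (fun y => φ (X y))) w a b = φ (fderiv ℂ (fderiv ℂ X) w a b) := by
  have d1 := fderiv_diff hX
  have hc : Differentiable ℂ (fun y => φ (X y)) := φ.differentiable.comp hX
  have e : ∀ y, fderiv ℂ (fun y => φ (X y)) y b = φ (fderiv ℂ X y b) := by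
    intro y
    have := (φ.hasFDerivAt.comp y (hX y).hasFDerivAt).fderiv
    rw [Function.comp_def] at this
    rw [this]; rfl
  have h1 := (ContinuousLinearMap.apply ℂ ℂ b).hasFDerivAt.comp_hasDerivAt (0:ℂ)
      (hasDerivAt_line (fderiv_diff hc) w a 0)
  have h2 := φ.hasFDerivAt.comp_hasDerivAt (0:ℂ) (hasDerivAt_line1 d1 w a b 0)
  simp only [zero_smul, add_zero, Function.comp_def, ContinuousLinearMap.apply_apply, e] at h1 h2
  exact h1.unique h2

/-- The vector field associated with a pair. -/
def fld (Y : (Fin n → Wsp n m → ℂ) × (Fin m → Wsp n m → ℂ)) (w : Wsp n m) : Wsp n m :=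
  (fun j => Y.1 j w, fun μ => Y.2 μ w)

theorem mem_iff (Y : (Fin n → Wsp n m → ℂ) × (Fin m → Wsp n m → ℂ)) :
    Y ∈ EntireSym0 n m ↔ Differentiable ℂ (fld Y) ∧ ∀ (w : Wsp n m) (q : Jsp n m) (i j : Fin n)
      (μ : Fin m), (fderiv ℂ (fderiv ℂ (fld Y)) w (vv q j) (vv q i)).2 μ
        = ∑ l, (fderiv ℂ (fderiv ℂ (fld Y)) w (vv q j) (vv q i)).1 l * q μ l := by
  have hdiff : Differentiable ℂ (fld Y) ↔ (∀ j, Differentiable ℂ (Y.1 j)) ∧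
      (∀ μ, Differentiable ℂ (Y.2 μ)) := by
    constructor
    · intro h
      exact ⟨fun j => by
        have := ((ContinuousLinearMap.proj (R := ℂ) (φ := fun _ : Fin n => ℂ) j).comp
          (ContinuousLinearMap.fst ℂ (Fin n → ℂ) (Fin m → ℂ))).differentiable.comp h
        exact this, fun j => by
        have := ((ContinuousLinearMap.proj (R := ℂ) (φ := fun _ : Fin m => ℂ) j).comp
          (ContinuousLinearMap.snd ℂ (Fin n → ℂ) (Fin m → ℂ))).differentiable.comp h
        exact this⟩
    · rintro ⟨h1, h2⟩
      exact (differentiable_pi.2 h1).prodMk (differentiable_pi.2 h2)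
  have key : Differentiable ℂ (fld Y) → ∀ (μ : Fin m) (i j : Fin n) (p : Psp n m),
      eta2 (fun _ _ _ _ => 0) Y.1 Y.2 μ i j p =
        (fderiv ℂ (fderiv ℂ (fld Y)) p.1 (vv p.2 j) (vv p.2 i)).2 μ
        - ∑ l, (fderiv ℂ (fderiv ℂ (fld Y)) p.1 (vv p.2 j) (vv p.2 i)).1 l * p.2 μ l := by
    intro h μ i j p
    rw [eta2_eq (hdiff.1 h).1 (hdiff.1 h).2]
    have e1 : ∀ l a b, fderiv ℂ (fderiv ℂ (Y.1 l)) p.1 a b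
        = (fderiv ℂ (fderiv ℂ (fld Y)) p.1 a b).1 l := fun l a b =>
      comp_D2 h ((ContinuousLinearMap.proj (R := ℂ) (φ := fun _ : Fin n => ℂ) l).comp
          (ContinuousLinearMap.fst ℂ (Fin n → ℂ) (Fin m → ℂ))) p.1 a b
    have e2 : ∀ l a b, fderiv ℂ (fderiv ℂ (Y.2 l)) p.1 a b
        = (fderiv ℂ (fderiv ℂ (fld Y)) p.1 a b).2 l := fun l a b =>
      comp_D2 h ((ContinuousLinearMap.proj (R := ℂ) (φ := fun _ : Fin m => ℂ) l).comp
          (ContinuousLinearMap.snd ℂ (Fin n → ℂ) (Fin m → ℂ))) p.1 a b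
    simp only [e1, e2]
  constructor
  · rintro ⟨h1, h2, h3⟩
    have h := hdiff.2 ⟨h1, h2⟩
    refine ⟨h, fun w q i j μ => ?_⟩
    have := h3 (w, q) (by simp) i j μ
    rw [key h] at this
    simp only [fderiv_fun_const, Pi.zero_apply, zero_apply, mul_zero,
      Finset.sum_const_zero, add_zero] at this
    exact sub_eq_zero.1 this
  · rintro ⟨h, h3⟩
    refine ⟨(hdiff.1 h).1, (hdiff.1 h).2, fun p _ i j μ => ?_⟩
    rw [key h, h3 p.1 p.2 i j μ]
    simp

theorem quad_line (B : Wsp (n+1) (m+1) →L[ℂ] Wsp (n+1) (m+1) →L[ℂ] Wsp (n+1) (m+1))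
    (hs : ∀ a b, B a b = B b a)
    (h : ∀ (q : Jsp (n+1) (m+1)) i j μ, (B (vv q j) (vv q i)).2 μ
        = ∑ l, (B (vv q j) (vv q i)).1 l * q μ l) (v : Wsp (n+1) (m+1)) :
    ∃ k : ℂ, B v v = k • v := by
  have h1 : ∀ (q : Jsp (n+1) (m+1)) (a : Fin (n+1) → ℂ) (c : Fin (m+1) → ℂ)
      (_ : ∀ μ, c μ = ∑ i, a i * q μ i) (μ : Fin (m+1)),
      (B (a, c) (a, c)).2 μ = ∑ l, (B (a, c) (a, c)).1 l * q μ l := by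
    intro q a c hc μ
    have e : ((a, c) : Wsp (n+1) (m+1)) = ∑ i, a i • vv q i := by
      ext s
      · simp [Prod.fst_sum, vv, Pi.single_apply]
      · simp [Prod.snd_sum, vv, hc]
    let Λ : Wsp (n+1) (m+1) →ₗ[ℂ] ℂ :=
      (LinearMap.proj (R := ℂ) (φ := fun _ : Fin (m+1) => ℂ) μ).comp (LinearMap.snd ℂ _ _) -
        ∑ l, q μ l • (LinearMap.proj (R := ℂ) (φ := fun _ : Fin (n+1) => ℂ) l).comp
          (LinearMap.fst ℂ _ _)
    have hΛ : ∀ z, Λ z = z.2 μ - ∑ l, z.1 l * q μ l := by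
      intro z
      simp [Λ, LinearMap.sum_apply, mul_comm]
    rw [← sub_eq_zero, ← hΛ, e]
    simp only [map_sum, map_smul, sum_apply, smul_apply]
    refine Finset.sum_eq_zero fun i _ => ?_
    refine smul_eq_zero_of_right _ (Finset.sum_eq_zero fun j _ => ?_)
    refine smul_eq_zero_of_right _ ?_
    rw [hΛ, h, sub_self]
  have h2 : ∀ (a : Fin (n+1) → ℂ) (c : Fin (m+1) → ℂ), a ≠ 0 → ∃ k : ℂ,
      B (a, c) (a, c) = k • (a, c) := by
    intro a c ha
    obtain ⟨i, hi⟩ := Function.ne_iff.1 ha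
    simp only [Pi.zero_apply] at hi
    set z := B (a, c) (a, c) with hz
    have q0 := h1 (fun μ l => if l = i then c μ / a i else 0) a c (by
      intro μ; simp [mul_div_cancel₀ _ hi])
    simp only [← hz, mul_ite, mul_zero, Finset.sum_ite_eq', Finset.mem_univ, if_true] at q0
    refine ⟨z.1 i / a i, ?_⟩
    ext l
    · have q1 := h1 (fun μ s => (if s = i then c μ / a i else 0) +
        ((if s = l then a i else 0) - (if s = i then a l else 0))) a c (by
        intro μ
        simp [mul_add, mul_sub, Finset.sum_add_distrib, mul_div_cancel₀ _ hi]; ring) 0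
      simp only [← hz, mul_add, mul_sub, mul_ite, mul_zero, Finset.sum_add_distrib,
        Finset.sum_sub_distrib, Finset.sum_ite_eq', Finset.mem_univ, if_true, q0] at q1
      simp only [Prod.smul_fst, Pi.smul_apply, smul_eq_mul]
      field_simp
      linear_combination -q1
    · simp only [Prod.smul_snd, Pi.smul_apply, smul_eq_mul, q0]
      field_simp
  obtain ⟨a, c⟩ := v
  by_cases ha : a = 0
  swap
  · exact h2 a c ha
  subst ha
  by_cases hc : c = 0
  · exact ⟨0, by subst hc; rw [Prod.mk_zero_zero]; simp⟩
  obtain ⟨ν, hν⟩ := Function.ne_iff.1 hc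
  simp only [Pi.zero_apply] at hν
  set e : Fin (n+1) → ℂ := fun _ => 1 with he
  have hne : ∀ t : ℂ, t ≠ 0 → t • e ≠ 0 := by
    intro t ht h0
    have := congrFun h0 0
    simp [he, ht] at this
  have hsum : ∀ t : ℂ, ((t • e, c) : Wsp (n+1) (m+1)) = (0, c) + t • (e, 0) := by
    intro t; simp
  obtain ⟨k1, hk1⟩ := h2 ((1:ℂ) • e) c (hne _ one_ne_zero)
  obtain ⟨k2, hk2⟩ := h2 ((-1:ℂ) • e) c (hne _ (by norm_num))
  obtain ⟨k3, hk3⟩ := h2 ((2:ℂ) • e) c (hne _ two_ne_zero)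
  obtain ⟨ε, hε⟩ := h2 e 0 (by simpa using hne 1 one_ne_zero)
  rw [hsum] at hk1 hk2 hk3
  have hsy := hs (e, 0) (0, c)
  simp only [map_add, map_smul, add_apply, smul_apply, hsy, hε] at hk1 hk2 hk3
  set P := B (0, c) (0, c) with hP
  set R := B (0, c) (e, 0) with hR
  have f1 : ∀ s, _ := fun s => congrFun (congrArg Prod.fst hk1) s
  have f2 : ∀ s, _ := fun s => congrFun (congrArg Prod.fst hk2) s
  have f3 : ∀ s, _ := fun s => congrFun (congrArg Prod.fst hk3) s
  have g1 : ∀ s, _ := fun s => congrFun (congrArg Prod.snd hk1) s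
  have g2 : ∀ s, _ := fun s => congrFun (congrArg Prod.snd hk2) s
  have g3 : ∀ s, _ := fun s => congrFun (congrArg Prod.snd hk3) s
  simp only [he, Prod.fst_add, Prod.snd_add, Prod.smul_fst, Prod.smul_snd, Pi.add_apply,
    Pi.smul_apply, smul_eq_mul, Pi.zero_apply, mul_zero, add_zero, zero_add, mul_one,
    one_mul] at f1 f2 f3 g1 g2 g3
  have hk : k3 = (3 * k1 - k2) / 2 := by
    apply mul_right_cancel₀ hν
    linear_combination (3/2) * g1 ν - (1/2) * g2 ν - g3 ν
  refine ⟨(k1 + k2) / 2, ?_⟩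
  ext s
  · simp only [Prod.smul_fst, Pi.smul_apply, Pi.zero_apply, smul_zero]
    linear_combination f1 s + (1/3) * f2 s - (1/3) * f3 s - (2/3) * hk
  · simp only [Prod.smul_snd, Pi.smul_apply, smul_eq_mul]
    linear_combination (1/2) * g1 s + (1/2) * g2 s

end Jets
section Final

theorem quad_hasFDerivAt {E : Type*} [NormedAddCommGroup E] [NormedSpace ℂ E]
    [FiniteDimensional ℂ E] (A : E) (L : E →ₗ[ℂ] E) (l : E →ₗ[ℂ] ℂ) (w : E) :
    HasFDerivAt (fun w => A + L w + l w • w)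
      (LinearMap.toContinuousLinearMap L + (l w • ContinuousLinearMap.id ℂ E
        + (LinearMap.toContinuousLinearMap l).smulRight w)) w := by
  have h1 : HasFDerivAt (fun w => A + L w) (LinearMap.toContinuousLinearMap L) w :=
    (LinearMap.toContinuousLinearMap L).hasFDerivAt.const_add A
  have h2 : HasFDerivAt (fun w => l w) (LinearMap.toContinuousLinearMap l) w :=
    (LinearMap.toContinuousLinearMap l).hasFDerivAt
  exact h1.fun_add (h2.fun_smul (hasFDerivAt_id w))

theorem quad_D2 {E : Type*} [NormedAddCommGroup E] [NormedSpace ℂ E]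
    [FiniteDimensional ℂ E] (A : E) (L : E →ₗ[ℂ] E) (l : E →ₗ[ℂ] ℂ) (w a b : E) :
    fderiv ℂ (fderiv ℂ (fun w => A + L w + l w • w)) w a b = l a • b + l b • a := by
  have hX : Differentiable ℂ (fun w => A + L w + l w • w) := fun w =>
    (quad_hasFDerivAt A L l w).differentiableAt
  have e : ∀ y, fderiv ℂ (fun w => A + L w + l w • w) y b = L b + (l y • b + l b • y) := by
    intro y
    rw [(quad_hasFDerivAt A L l y).fderiv]
    simp
  have h1 := hasDerivAt_line1 (fderiv_diff hX) w a b 0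
  simp only [e] at h1
  have h2 : HasDerivAt (fun s : ℂ => L b + (l (w + s • a) • b + l b • (w + s • a)))
      (l a • b + l b • a) 0 := by
    have k1 : HasDerivAt (fun s : ℂ => w + s • a) a 0 := by
      simpa using ((hasDerivAt_id (0:ℂ)).smul_const a).const_add w
    have k2 : HasDerivAt (fun s : ℂ => l (w + s • a)) (l a) 0 :=
      (LinearMap.toContinuousLinearMap l).hasFDerivAt.comp_hasDerivAt (0:ℂ) k1
    exact ((k2.smul_const b).fun_add (k1.const_smul (l b))).const_add (L b)
  simpa using h1.unique h2

/-- Parametrization of the symmetries. -/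
def PhiMap (n m : ℕ) : (Wsp n m × (Wsp n m →ₗ[ℂ] Wsp n m) × (Wsp n m →ₗ[ℂ] ℂ)) →ₗ[ℂ]
    ((Fin n → Wsp n m → ℂ) × (Fin m → Wsp n m → ℂ)) where
  toFun x := (fun j w => (x.1 + x.2.1 w + x.2.2 w • w).1 j,
    fun μ w => (x.1 + x.2.1 w + x.2.2 w • w).2 μ)
  map_add' x y := by
    ext <;> simp <;> ring
  map_smul' c x := by
    ext <;> simp <;> ring

theorem fld_Phi {n m : ℕ} (x : Wsp n m × (Wsp n m →ₗ[ℂ] Wsp n m) × (Wsp n m →ₗ[ℂ] ℂ)) :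
    fld (PhiMap n m x) = fun w => x.1 + x.2.1 w + x.2.2 w • w := rfl

theorem fld_inj {n m : ℕ} : Function.Injective
    (fld : ((Fin n → Wsp n m → ℂ) × (Fin m → Wsp n m → ℂ)) → Wsp n m → Wsp n m) := by
  intro Y Z h
  refine Prod.ext ?_ ?_
  · funext j w
    exact congrFun (congrArg Prod.fst (congrFun h w)) j
  · funext j w
    exact congrFun (congrArg Prod.snd (congrFun h w)) j

theorem Phi_inj (n m : ℕ) : Function.Injective (PhiMap n m) := by
  rw [injective_iff_map_eq_zero]
  rintro ⟨A, L, l⟩ hx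
  have h : ∀ w, A + L w + l w • w = 0 := by
    intro w
    have := congrFun (congrArg fld hx) w
    rw [fld_Phi] at this
    exact this
  have hA : A = 0 := by simpa using h 0
  have hL : ∀ w, L w = 0 := by
    intro w
    have h1 := h w
    have h2 := h (-w)
    simp only [hA, map_neg, neg_smul, smul_neg, neg_neg, zero_add] at h1 h2
    have h3 : (2:ℂ) • L w = 0 := by
      linear_combination (norm := module) h1 - h2
    exact (smul_eq_zero.1 h3).resolve_left two_ne_zero
  have hl : ∀ w, l w = 0 := by
    intro w
    have h1 := h w
    rw [hA, hL, zero_add, zero_add] at h1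
    rcases smul_eq_zero.1 h1 with h2 | h2
    · exact h2
    · rw [h2, map_zero]
  simp only [Prod.mk_eq_zero]
  exact ⟨hA, LinearMap.ext hL, LinearMap.ext hl⟩

end Final

/-- The complex vector space of infinitesimal symmetries of the trivial
system `(S_0) : u^k_{x_i x_j} = 0`, with `θ, η` holomorphic on all of `ℂⁿ × ℂᵐ`, has
complex dimension exactly `(n+m+2)(n+m)`: it is (the coercion of) a finite-dimensional
complex submodule of the space of pairs of function families, of finrank
`(n+m+2)(n+m)`.  In particular the upper bound `(n+m+2)(n+m)` for the dimension of the
symmetry algebra of a holomorphic completely overdetermined involutive second order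
system is attained. -/
theorem statement4 (n m : ℕ) :
    ∃ S : Submodule ℂ ((Fin (n + 1) → Wsp (n + 1) (m + 1) → ℂ)
        × (Fin (m + 1) → Wsp (n + 1) (m + 1) → ℂ)),
      (S : Set _) = EntireSym0 (n + 1) (m + 1) ∧
      Module.Finite ℂ S ∧
      Module.finrank ℂ S = (n + 1 + (m + 1) + 2) * (n + 1 + (m + 1)) := by
  have hE : 1 < Module.finrank ℂ (Wsp (n + 1) (m + 1)) := by
    rw [Module.finrank_prod, Module.finrank_fin_fun, Module.finrank_fin_fun]; omega
  refine ⟨LinearMap.range (PhiMap (n + 1) (m + 1)), ?_, inferInstance, ?_⟩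
  · ext Y
    rw [SetLike.mem_coe, LinearMap.mem_range, mem_iff]
    constructor
    · rintro ⟨x, rfl⟩
      rw [fld_Phi]
      refine ⟨fun w => (quad_hasFDerivAt _ _ _ w).differentiableAt, fun w q i j μ => ?_⟩
      rw [quad_D2]
      simp only [Prod.snd_add, Prod.fst_add, Prod.smul_fst, Prod.smul_snd, Pi.add_apply,
        Pi.smul_apply, smul_eq_mul, vv, add_mul, Finset.sum_add_distrib]
      simp [Pi.single_apply]
    · rintro ⟨h1, h2⟩
      have sB : ∀ w a b, fderiv ℂ (fderiv ℂ (fld Y)) w a b = fderiv ℂ (fderiv ℂ (fld Y)) w b a :=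
        fun w a b => second_derivative_symmetric (fun y => (h1 y).hasFDerivAt)
          (fderiv_diff h1 w).hasFDerivAt a b
      obtain ⟨A, L, l, hX⟩ := struct_thm h1 hE fun w v =>
        quad_line (fderiv ℂ (fderiv ℂ (fld Y)) w) (sB w) (h2 w) v
      refine ⟨(A, L, l), fld_inj ?_⟩
      rw [fld_Phi]
      funext w
      exact (hX w).symm
  · rw [LinearMap.finrank_range_of_inj (Phi_inj _ _)]
    simp only [Module.finrank_prod, Module.finrank_linearMap, Module.finrank_fin_fun,
      Module.finrank_self]
    ring
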